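/- Let p be a prime. There exist a profinite set Y and a continuous action of the additive group ℤ_p of p-adic integers on Y such that the set Δ(Y) = {y ∈ Y : the orbit ℤ_p·y is finite} of points with finite orbit is not closed in Y. -/

import Mathlib

/-- Let `p` be a prime.  There exist a profinite set `Y` and a continuous
action of the additive group `ℤ_p` of `p`-adic integers on `Y` such that the set of points
of `Y` with finite orbit is not closed in `Y`. -/
theorem stmt_7 (p : ℕ) [Fact p.Prime] :
    ∃ (Y : Profinite) (act : ℤ_[p] → Y → Y),
      (∀ y : Y, act 0 y = y) ∧
      (∀ (a b : ℤ_[p]) (y : Y), act (a + b) y = act a (act b y)) ∧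
      Continuous (fun z : ℤ_[p] × Y => act z.1 z.2) ∧
      ¬ IsClosed {y : Y | {z : Y | ∃ a : ℤ_[p], act a y = z}.Finite} := by
  let _ : ∀ n : ℕ, TopologicalSpace (ZMod (p ^ n)) := fun n => ⊥
  have : ∀ n : ℕ, DiscreteTopology (ZMod (p ^ n)) := fun n => ⟨rfl⟩
  have : ∀ n : ℕ, Finite (ZMod (p ^ n)) := fun n => inferInstance
  let act : ℤ_[p] → ((ULift ℕ → Bool) × (∀ n : ℕ, ZMod (p ^ n))) →
      ((ULift ℕ → Bool) × (∀ n : ℕ, ZMod (p ^ n))) := fun a y =>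
    (y.1, fun n => (if y.1 ⟨n⟩ then PadicInt.toZModPow n a else 0) + y.2 n)
  have hc : ∀ n, Continuous (fun a : ℤ_[p] => PadicInt.toZModPow n a) := by
    intro n
    refine (IsLocallyConstant.iff_eventually_eq _).2 ?_ |>.continuous
    intro x
    have hp : (0 : ℝ) < (p : ℝ) ^ (-n : ℤ) := by
      have := (Fact.out : p.Prime).pos
      positivity
    filter_upwards [Metric.closedBall_mem_nhds x hp] with y hy
    rw [← sub_eq_zero, ← map_sub, ← RingHom.mem_ker, PadicInt.ker_toZModPow,
      ← PadicInt.norm_le_pow_iff_mem_span_pow]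
    rwa [Metric.mem_closedBall, dist_eq_norm] at hy
  refine ⟨Profinite.of ((ULift ℕ → Bool) × (∀ n : ℕ, ZMod (p ^ n))), act, ?_, ?_, ?_, ?_⟩
  · rintro ⟨e, y⟩
    simp [act]
  · rintro a b ⟨e, y⟩
    refine Prod.ext rfl ?_
    funext n
    by_cases h : e ⟨n⟩ <;> simp [act, h, add_assoc]
  · change Continuous (fun z : ℤ_[p] × ((ULift ℕ → Bool) × (∀ n : ℕ, ZMod (p ^ n))) => act z.1 z.2)
    refine Continuous.prodMk (by fun_prop) (continuous_pi fun n => ?_)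
    have h1 : Continuous (fun q : ZMod (p ^ n) × Bool × ZMod (p ^ n) =>
      (if q.2.1 then q.1 else 0) + q.2.2) := continuous_of_discreteTopology
    have h2 : Continuous (fun z : ℤ_[p] × ((ULift ℕ → Bool) × (∀ n : ℕ, ZMod (p ^ n))) =>
      (PadicInt.toZModPow n z.1, z.2.1 ⟨n⟩, z.2.2 n)) :=
      ((hc n).comp continuous_fst).prodMk (by fun_prop)
    exact h1.comp h2
  · intro hcl
    let u : ℕ → ((ULift ℕ → Bool) × (∀ n : ℕ, ZMod (p ^ n))) := fun N => (fun n => decide (n.down < N), 0)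
    have ht : Filter.Tendsto u Filter.atTop (nhds (fun _ => true, 0)) := by
      refine Filter.Tendsto.prodMk_nhds (tendsto_pi_nhds.2 fun n => ?_) tendsto_const_nhds
      refine tendsto_const_nhds.congr' ?_
      filter_upwards [Filter.eventually_gt_atTop n.down] with N hN
      simp [hN]
    have hm := hcl.mem_of_tendsto ht (Filter.Eventually.of_forall fun N => ?_)
    · have hf : (Set.range fun a => act a (fun _ => true, 0)).Finite := hm
      refine Set.infinite_range_of_injective (f := fun a => act a (fun _ => true, 0)) ?_ hf
      intro a b hab
      refine PadicInt.ext_of_toZModPow.1 fun n => ?_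
      have := congrFun (congrArg Prod.snd hab) n
      simpa [act] using this
    · change (Set.range fun a => act a (u N)).Finite
      refine (Set.finite_range (fun c : ZMod (p ^ N) =>
        ((u N).1, fun n => if n < N then (c.cast : ZMod (p ^ n)) else 0))).subset ?_
      rintro _ ⟨a, rfl⟩
      refine ⟨PadicInt.toZModPow N a, Prod.ext rfl ?_⟩
      funext n
      by_cases h : n < N
      · simp [act, u, h, PadicInt.cast_toZModPow n N h.le a]
      · simp [act, u, h]
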